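/- arXiv:2604.28005 — 4 statements merged into one kernel-verified Lean document; each statement's English description precedes it below -/
import Mathlib

section
/- Let X and Y be nonempty finite types, d a natural number, p : X → ℝ a probability mass function, q : X → Y → ℝ with q x y ≥ 0 and ∑_y q x y = 1 for every x, r : X → Y → ℝ, and S : X → Y → (EuclideanSpace ℝ (Fin d)). Assume (i) zero conditional mean of the score: ∑_y q x y • S x y = 0 for every x; and (ii) conditional uncorrelatedness: ∑_y q x y · r x y · ‖S x y‖² = (∑_y q x y · r x y) · (∑_y q x y · ‖S x y‖²) for every x. Define the value function V x = ∑_y q x y · r x y and the target g = ∑_{x,y} p x · q x y · r x y • S x y. Then for every baseline b : X → ℝ, the mean squared error of the advantage-weighted estimator decomposes as: ∑_{x,y} p x · q x y · ‖(r x y − b x) • S x y − g‖² = ∑_{x,y} p x · q x y · ‖(r x y − V x) • S x y − g‖² + ∑_{x,y} p x · q x y · (V x − b x)² · ‖S x y‖². -/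
/-- Changing the coefficient of `s` from `a - v` to `a - b` changes the squared distance to `g` by a
quadratic term and a cross term. -/
theorem norm_sub_smul_sub_sq {E : Type*} [NormedAddCommGroup E] [InnerProductSpace ℝ E]
    (a b v : ℝ) (s g : E) :
    ‖(a - b) • s - g‖ ^ 2 = ‖(a - v) • s - g‖ ^ 2 + (v - b) ^ 2 * ‖s‖ ^ 2 +
      2 * (v - b) * ((a - v) * ‖s‖ ^ 2 - inner ℝ s g) := by
  simp only [norm_sub_sq_real, norm_smul, mul_pow, Real.norm_eq_abs, sq_abs, real_inner_smul_left]
  ring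

/-- The cross term averages to zero when `S` has zero mean and `‖S‖ ^ 2` is uncorrelated with `r`. -/
theorem sum_mul_sub_mean_mul_norm_sq_sub_inner_eq_zero {Y E : Type*} [Fintype Y]
    [NormedAddCommGroup E] [InnerProductSpace ℝ E] (q r : Y → ℝ) (S : Y → E) (g : E)
    (hzero : ∑ y, q y • S y = 0)
    (huncorr : ∑ y, q y * r y * ‖S y‖ ^ 2 = (∑ y, q y * r y) * ∑ y, q y * ‖S y‖ ^ 2) :
    ∑ y, q y * ((r y - ∑ z, q z * r z) * ‖S y‖ ^ 2 - inner ℝ (S y) g) = 0 := by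
  have hinner : ∑ y, q y * inner ℝ (S y) g = 0 := by
    simp only [← real_inner_smul_left, ← sum_inner, hzero, inner_zero_left]
  simp only [mul_sub, sub_mul, Finset.sum_sub_distrib, hinner, ← mul_assoc, huncorr]
  rw [sub_zero, sub_eq_zero, Finset.mul_sum]
  exact Finset.sum_congr rfl fun y _ => by ring

/-- **MSE decomposition of the advantage-weighted policy gradient estimator.**
Under zero conditional mean of the score and conditional uncorrelatedness of
the reward and the squared norm of the score, the mean squared error of the
gradient estimator with baseline `b` equals the MSE of the oracle estimator
(with the value function `V` as baseline) plus the weighted squared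
baseline error. -/
theorem mse_decomposition_baseline {X : Type*} {Y : Type*}
    [Fintype X] [Nonempty X] [Fintype Y] [Nonempty Y] (d : ℕ)
    (p : X → ℝ) (hp : ∀ x, 0 ≤ p x) (hpsum : ∑ x, p x = 1)
    (q : X → Y → ℝ) (hq : ∀ x y, 0 ≤ q x y) (hqsum : ∀ x, ∑ y, q x y = 1)
    (r : X → Y → ℝ) (S : X → Y → EuclideanSpace ℝ (Fin d))
    (hzero : ∀ x, ∑ y, q x y • S x y = 0)
    (huncorr : ∀ x, ∑ y, q x y * r x y * ‖S x y‖ ^ 2 =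
      (∑ y, q x y * r x y) * (∑ y, q x y * ‖S x y‖ ^ 2))
    (V : X → ℝ) (hV : ∀ x, V x = ∑ y, q x y * r x y)
    (g : EuclideanSpace ℝ (Fin d))
    (hg : g = ∑ x, ∑ y, (p x * q x y * r x y) • S x y)
    (b : X → ℝ) :
    ∑ x, ∑ y, p x * q x y * ‖(r x y - b x) • S x y - g‖ ^ 2 =
      (∑ x, ∑ y, p x * q x y * ‖(r x y - V x) • S x y - g‖ ^ 2) +
        ∑ x, ∑ y, p x * q x y * ((V x - b x) ^ 2 * ‖S x y‖ ^ 2) := by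
  simp only [← Finset.sum_add_distrib]
  refine Finset.sum_congr rfl fun x _ => ?_
  have hcross := sum_mul_sub_mean_mul_norm_sq_sub_inner_eq_zero (q x) (r x) (S x) g
    (hzero x) (huncorr x)
  rw [← hV x] at hcross
  rw [← sub_eq_zero, ← Finset.sum_sub_distrib, ← mul_zero (p x * (2 * (V x - b x))), ← hcross,
    Finset.mul_sum]
  refine Finset.sum_congr rfl fun y _ => ?_
  rw [norm_sub_smul_sub_sq (r x y) (b x) (V x)]
  ring
end

section
/- Let X and Y be nonempty finite types, d a natural number, p : X → ℝ a probability mass function, q : X → Y → ℝ with q x y ≥ 0 and ∑_y q x y = 1 for every x, r : X → Y → ℝ, and S : X → Y → (EuclideanSpace ℝ (Fin d)). Assume (i) ∑_y q x y • S x y = 0 for every x, and (ii) ∑_y q x y · r x y · ‖S x y‖² = (∑_y q x y · r x y) · (∑_y q x y · ‖S x y‖²) for every x. Define V x = ∑_y q x y · r x y. Then for every baseline b : X → ℝ, ∑_{x,y} p x · q x y · ‖(r x y − b x) • S x y‖² = ∑_{x,y} p x · q x y · ‖(r x y − V x) • S x y‖² + ∑_{x,y} p x · q x y · (V x − b x)²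 · ‖S x y‖². In particular, the value function V is the baseline minimizing the second moment ∑_{x,y} p x · q x y · ‖(r x y − b x) • S x y‖² over all b : X → ℝ. -/
/-- If the weighted sum of `f y * ‖v y‖ ^ 2` equals `m` times the weighted sum of `‖v y‖ ^ 2`, then
the weighted second moment of `(f y - c) • v y` splits into the one centred at `m` plus a bias
term. -/
theorem sum_mul_norm_sub_smul_sq {Y E : Type*} [Fintype Y] [SeminormedAddCommGroup E]
    [NormedSpace ℝ E] (w f : Y → ℝ) (v : Y → E) (m c : ℝ)
    (h : ∑ y, w y * f y * ‖v y‖ ^ 2 = m * ∑ y, w y * ‖v y‖ ^ 2) :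
    ∑ y, w y * ‖(f y - c) • v y‖ ^ 2 =
      ∑ y, w y * ‖(f y - m) • v y‖ ^ 2 + ∑ y, w y * ((m - c) ^ 2 * ‖v y‖ ^ 2) := by
  have cross : ∑ y, 2 * (m - c) * (w y * f y * ‖v y‖ ^ 2 - m * (w y * ‖v y‖ ^ 2)) = 0 := by
    rw [← Finset.mul_sum, Finset.sum_sub_distrib, ← Finset.mul_sum, h, sub_self, mul_zero]
  rw [← add_zero (_ + _), ← cross, ← Finset.sum_add_distrib, ← Finset.sum_add_distrib]
  refine Finset.sum_congr rfl fun y _ => ?_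
  simp only [norm_smul, mul_pow, Real.norm_eq_abs, sq_abs]
  ring

/-- **Second-moment decomposition and optimality of the value-function baseline.**
Under zero conditional mean of the score and conditional uncorrelatedness of
the reward and the squared norm of the score, the second moment of the
advantage-weighted estimator with baseline `b` equals the second moment with
the value function `V` as baseline plus a nonnegative term; in particular `V`
minimizes the second moment over all baselines. -/
theorem value_function_optimal_baseline {X : Type*} {Y : Type*}
    [Fintype X] [Nonempty X] [Fintype Y] [Nonempty Y] (d : ℕ)
    (p : X → ℝ) (hp : ∀ x, 0 ≤ p x) (hpsum : ∑ x, p x = 1)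
    (q : X → Y → ℝ) (hq : ∀ x y, 0 ≤ q x y) (hqsum : ∀ x, ∑ y, q x y = 1)
    (r : X → Y → ℝ) (S : X → Y → EuclideanSpace ℝ (Fin d))
    (hzero : ∀ x, ∑ y, q x y • S x y = 0)
    (huncorr : ∀ x, ∑ y, q x y * r x y * ‖S x y‖ ^ 2 =
      (∑ y, q x y * r x y) * (∑ y, q x y * ‖S x y‖ ^ 2))
    (V : X → ℝ) (hV : ∀ x, V x = ∑ y, q x y * r x y) :
    (∀ b : X → ℝ,
      ∑ x, ∑ y, p x * q x y * ‖(r x y - b x) • S x y‖ ^ 2 =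
        (∑ x, ∑ y, p x * q x y * ‖(r x y - V x) • S x y‖ ^ 2) +
          ∑ x, ∑ y, p x * q x y * ((V x - b x) ^ 2 * ‖S x y‖ ^ 2)) ∧
    (∀ b : X → ℝ,
      ∑ x, ∑ y, p x * q x y * ‖(r x y - V x) • S x y‖ ^ 2 ≤
        ∑ x, ∑ y, p x * q x y * ‖(r x y - b x) • S x y‖ ^ 2) := by
  have decomp : ∀ b : X → ℝ,
      ∑ x, ∑ y, p x * q x y * ‖(r x y - b x) • S x y‖ ^ 2 =
        (∑ x, ∑ y, p x * q x y * ‖(r x y - V x) • S x y‖ ^ 2) +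
          ∑ x, ∑ y, p x * q x y * ((V x - b x) ^ 2 * ‖S x y‖ ^ 2) := by
    intro b
    rw [← Finset.sum_add_distrib]
    refine Finset.sum_congr rfl fun x _ => ?_
    simp only [mul_assoc (p x), ← Finset.mul_sum, ← mul_add]
    rw [sum_mul_norm_sub_smul_sq (q x) (r x) (S x) (V x) (b x) (by rw [huncorr, hV])]
  refine ⟨decomp, fun b => ?_⟩
  rw [decomp b]
  exact le_add_of_nonneg_right <| Finset.sum_nonneg fun x _ => Finset.sum_nonneg fun y _ =>
    mul_nonneg (mul_nonneg (hp x) (hq x y)) (by positivity)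
end

section
/- Let K : ℝ → ℝ vanish outside [0,1], satisfy |K(u)| ≤ κ for all u, and be Lipschitz with constant Λ on the interval (0,1]. Let v : ℝ → ℝ be Lipschitz with constant L and satisfy |v(t)| ≤ L for all t. Then there exists a constant C depending only on (κ, Λ, L) such that for every natural number n ≥ 1 and every h ∈ (0,1] with n·h ≥ 1, the discretization error of the kernel sum satisfies |(1/(n·h)) · ∑_{j=0}^{n−1} K((n−j)/(n·h)) · v(j/n) − ∫₀¹ K(u) · v(1 − h·u) du| ≤ C / (n·h). -/
open intervalIntegral in
/-- Right-endpoint Riemann sums with mesh `1 / N` of a function on `(0, 1]` that is bounded by `B`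
and `M`-Lipschitz approximate its integral up to `(M + B) / N`. -/
theorem abs_riemannSum_sub_integral_le {g : ℝ → ℝ} {B M N : ℝ} (hN : 1 ≤ N) (hM : 0 ≤ M)
    (hB : ∀ u ∈ Set.Ioc (0 : ℝ) 1, |g u| ≤ B)
    (hg : ∀ u₁ ∈ Set.Ioc (0 : ℝ) 1, ∀ u₂ ∈ Set.Ioc (0 : ℝ) 1, |g u₁ - g u₂| ≤ M * |u₁ - u₂|) :
    |1 / N * ∑ i ∈ Finset.range ⌊N⌋₊, g (((i + 1 : ℕ) : ℝ) / N) - ∫ u in (0 : ℝ)..1, g u|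
      ≤ (M + B) / N := by
  have hN0 : 0 < N := by linarith
  have hB0 : 0 ≤ B := (abs_nonneg _).trans (hB 1 (by simp))
  have hcont : ContinuousOn g (Set.Ioc 0 1) := by
    have : LipschitzOnWith (Real.toNNReal M) g (Set.Ioc 0 1) :=
      LipschitzOnWith.of_dist_le_mul fun x hx y hy => by
        simpa [Real.dist_eq, Real.coe_toNNReal M hM] using hg x hx y hy
    exact this.continuousOn
  have hint : MeasureTheory.IntegrableOn g (Set.Ioc 0 1) :=
    MeasureTheory.IntegrableOn.of_bound (by simp) (hcont.aestronglyMeasurable measurableSet_Ioc) B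
      (MeasureTheory.ae_restrict_of_forall_mem measurableSet_Ioc hB)
  have hsub : ∀ {a b : ℝ}, 0 ≤ a → a ≤ b → b ≤ 1 →
      IntervalIntegrable g MeasureTheory.volume a b := fun ha hab hb =>
    (intervalIntegrable_iff_integrableOn_Ioc_of_le hab).2
      (hint.mono_set (Set.Ioc_subset_Ioc ha hb))
  set m := ⌊N⌋₊ with hm
  have hmN : (m : ℝ) ≤ N := Nat.floor_le hN0.le
  have hNm : N < m + 1 := Nat.lt_floor_add_one N
  have hm0 : (0 : ℝ) ≤ m / N := by positivity
  have hm1 : (m : ℝ) / N ≤ 1 := (div_le_one hN0).2 hmN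
  have hstep : ∀ i : ℕ, ((i + 1 : ℕ) : ℝ) / N - (i : ℝ) / N = 1 / N := fun i => by
    push_cast; ring
  have hcell0 : ∀ i : ℕ, (0 : ℝ) ≤ i / N := fun i => by positivity
  have hcell : ∀ i : ℕ, (i : ℝ) / N ≤ ((i + 1 : ℕ) : ℝ) / N := fun i => by
    gcongr; simp
  have hcell1 : ∀ i < m, ((i + 1 : ℕ) : ℝ) / N ≤ 1 := fun i hi => by
    refine le_trans ?_ hm1
    gcongr
    exact hi
  have hI : ∀ i < m, IntervalIntegrable g MeasureTheory.volume ((i : ℝ) / N)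
      (((i + 1 : ℕ) : ℝ) / N) := fun i hi => hsub (hcell0 i) (hcell i) (hcell1 i hi)
  have hsum := sum_integral_adjacent_intervals (a := fun i : ℕ => (i : ℝ) / N) hI
  simp only [Nat.cast_zero, zero_div] at hsum
  have hsplit := integral_add_adjacent_intervals (hsub le_rfl hm0 hm1) (hsub hm0 hm1 le_rfl)
  have htail : |∫ u in ((m : ℝ) / N)..1, g u| ≤ B / N := by
    have h1 : ‖∫ u in ((m : ℝ) / N)..1, g u‖ ≤ B * |1 - (m : ℝ) / N| :=
      norm_integral_le_of_norm_le_const fun u hu => by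
        rw [Set.uIoc_of_le hm1] at hu
        exact hB u ⟨hm0.trans_lt hu.1, hu.2⟩
    rw [abs_of_nonneg (by linarith), Real.norm_eq_abs] at h1
    refine h1.trans ?_
    rw [div_eq_mul_one_div B N]
    gcongr
    rw [sub_le_iff_le_add, ← add_div, le_div_iff₀ hN0]
    linarith
  have hone : ∀ i < m, |1 / N * g (((i + 1 : ℕ) : ℝ) / N)
      - ∫ u in ((i : ℝ) / N)..(((i + 1 : ℕ) : ℝ) / N), g u| ≤ M / N * (1 / N) := fun i hi => by
    have hconst : 1 / N * g (((i + 1 : ℕ) : ℝ) / N)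
        = ∫ _ in ((i : ℝ) / N)..(((i + 1 : ℕ) : ℝ) / N), g (((i + 1 : ℕ) : ℝ) / N) := by
      rw [integral_const, hstep, smul_eq_mul]
    rw [hconst, ← integral_sub intervalIntegrable_const (hI i hi)]
    have h1 := norm_integral_le_of_norm_le_const (a := (i : ℝ) / N) (b := ((i + 1 : ℕ) : ℝ) / N)
      (f := fun u => g (((i + 1 : ℕ) : ℝ) / N) - g u) (C := M / N) fun u hu => by
        rw [Set.uIoc_of_le (hcell i)] at hu
        have hu0 : 0 < u := (hcell0 i).trans_lt hu.1
        refine (hg _ ⟨hu0.trans_le hu.2, hcell1 i hi⟩ u ⟨hu0, hu.2.trans (hcell1 i hi)⟩).trans ?_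
        rw [abs_of_nonneg (by linarith [hu.2]), div_eq_mul_one_div M N]
        gcongr
        linarith [hu.1, hstep i]
    rwa [hstep, abs_of_pos (by positivity), Real.norm_eq_abs] at h1
  have hmain : |∑ i ∈ Finset.range m, (1 / N * g (((i + 1 : ℕ) : ℝ) / N)
      - ∫ u in ((i : ℝ) / N)..(((i + 1 : ℕ) : ℝ) / N), g u)| ≤ M / N := by
    refine (Finset.abs_sum_le_sum_abs _ _).trans <|
      (Finset.sum_le_sum fun i hi => hone i (Finset.mem_range.1 hi)).trans ?_
    rw [Finset.sum_const, Finset.card_range, nsmul_eq_mul]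
    calc (m : ℝ) * (M / N * (1 / N)) = M / N * (m / N) := by ring
      _ ≤ M / N * 1 := by gcongr
      _ = M / N := mul_one _
  rw [Finset.sum_sub_distrib, hsum, ← Finset.mul_sum] at hmain
  rw [← hsplit, ← sub_sub, add_div]
  exact (abs_sub _ _).trans (add_le_add hmain htail)

/-- **Discretization error of the kernel sum.**
For every choice of constants `κ, Λ, L` there is a constant `C` (depending only
on `(κ, Λ, L)`) such that for every kernel `K` supported in `[0,1]`, bounded by
`κ` and `Λ`-Lipschitz on `(0,1]`, and every `L`-Lipschitz, `L`-bounded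
function `v`, the Riemann-sum approximation of the kernel smoothing integral
has error at most `C / (n * h)`. -/
theorem kernel_sum_discretization_error (κ Λ L : ℝ) :
    ∃ C : ℝ, ∀ K : ℝ → ℝ, ∀ v : ℝ → ℝ,
      (∀ u, u ∉ Set.Icc (0 : ℝ) 1 → K u = 0) →
      (∀ u, |K u| ≤ κ) →
      (∀ u₁ ∈ Set.Ioc (0 : ℝ) 1, ∀ u₂ ∈ Set.Ioc (0 : ℝ) 1,
        |K u₁ - K u₂| ≤ Λ * |u₁ - u₂|) →
      (∀ t₁ t₂ : ℝ, |v t₁ - v t₂| ≤ L * |t₁ - t₂|) →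
      (∀ t : ℝ, |v t| ≤ L) →
      ∀ n : ℕ, 1 ≤ n → ∀ h : ℝ, h ∈ Set.Ioc (0 : ℝ) 1 → 1 ≤ (n : ℝ) * h →
        |(1 / ((n : ℝ) * h)) *
            (∑ j ∈ Finset.range n, K (((n : ℝ) - (j : ℝ)) / ((n : ℝ) * h)) * v ((j : ℝ) / (n : ℝ))) -
          ∫ u in (0:ℝ)..1, K u * v (1 - h * u)| ≤ C / ((n : ℝ) * h) := by
  refine ⟨Λ * L + κ * L + κ * L, fun K v hK hKκ hKΛ hv hvL n hn h hh hN => ?_⟩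
  have hκ : 0 ≤ κ := (abs_nonneg _).trans (hKκ 0)
  have hL : 0 ≤ L := (abs_nonneg _).trans (hvL 0)
  have hΛ : 0 ≤ Λ := by
    have h1 := (abs_nonneg _).trans
      (hKΛ 1 ⟨by norm_num, by norm_num⟩ (1 / 2) ⟨by norm_num, by norm_num⟩)
    norm_num [abs_of_pos] at h1
    exact h1
  have hn0 : (0 : ℝ) < n := by exact_mod_cast hn
  have hh0 : 0 < h := hh.1
  set N : ℝ := n * h with hNdef
  have hN0 : 0 < N := by linarith
  have hfloor : ⌊N⌋₊ ≤ n := Nat.floor_le_of_le (mul_le_of_le_one_right hn0.le hh.2)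
  have hbound : ∀ u ∈ Set.Ioc (0 : ℝ) 1, |K u * v (1 - h * u)| ≤ κ * L := fun u _ => by
    rw [abs_mul]
    exact mul_le_mul (hKκ u) (hvL _) (abs_nonneg _) hκ
  have hlip : ∀ u₁ ∈ Set.Ioc (0 : ℝ) 1, ∀ u₂ ∈ Set.Ioc (0 : ℝ) 1,
      |K u₁ * v (1 - h * u₁) - K u₂ * v (1 - h * u₂)| ≤ (Λ * L + κ * L) * |u₁ - u₂| := by
    intro u₁ h₁ u₂ h₂
    have hvh : |v (1 - h * u₁) - v (1 - h * u₂)| ≤ L * |u₁ - u₂| := by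
      refine (hv _ _).trans ?_
      rw [show 1 - h * u₁ - (1 - h * u₂) = -(h * (u₁ - u₂)) by ring, abs_neg, abs_mul,
        abs_of_pos hh0]
      gcongr
      exact mul_le_of_le_one_left (abs_nonneg _) hh.2
    calc |K u₁ * v (1 - h * u₁) - K u₂ * v (1 - h * u₂)|
        = |(K u₁ - K u₂) * v (1 - h * u₁) + K u₂ * (v (1 - h * u₁) - v (1 - h * u₂))| := by
          ring_nf
      _ ≤ |K u₁ - K u₂| * |v (1 - h * u₁)| + |K u₂| * |v (1 - h * u₁) - v (1 - h * u₂)| := by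
          rw [← abs_mul, ← abs_mul]
          exact abs_add_le _ _
      _ ≤ (Λ * |u₁ - u₂|) * L + κ * (L * |u₁ - u₂|) := by
          gcongr
          · exact hKΛ _ h₁ _ h₂
          · exact hvL _
          · exact hKκ _
      _ = (Λ * L + κ * L) * |u₁ - u₂| := by ring
  have hsum : ∑ j ∈ Finset.range n, K (((n : ℝ) - (j : ℝ)) / N) * v ((j : ℝ) / (n : ℝ))
      = ∑ i ∈ Finset.range ⌊N⌋₊,
          K (((i + 1 : ℕ) : ℝ) / N) * v (1 - h * (((i + 1 : ℕ) : ℝ) / N)) := by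
    rw [← Finset.sum_range_reflect]
    symm
    refine (Finset.sum_subset (Finset.range_mono hfloor) fun i _ hi => ?_).trans
      (Finset.sum_congr rfl fun i hi => ?_)
    · rw [hK, zero_mul]
      rintro ⟨-, hle⟩
      rw [div_le_one hN0] at hle
      exact hi (Finset.mem_range.2 (Nat.le_floor hle))
    · have hcast : ((n - 1 - i : ℕ) : ℝ) = n - ((i + 1 : ℕ) : ℝ) := by
        rw [← Nat.cast_sub (Finset.mem_range.1 hi)]
        congr 1
        omega
      rw [hcast, sub_sub_cancel, hNdef]
      congr 2
      field_simp
  rw [hsum]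
  exact abs_riemannSum_sub_integral_le hN (by positivity) hbound hlip
end

section
/- Let X and Y be nonempty finite types, d a natural number, p : X → ℝ a probability mass function, q : X → Y → ℝ with q x y ≥ 0 and ∑_y q x y = 1 for every x, r : X → Y → ℝ, and S : X → Y → (EuclideanSpace ℝ (Fin d)) satisfying (i) ∑_y q x y • S x y = 0 for every x, (ii) ∑_y q x y · r x y · ‖S x y‖² = (∑_y q x y · r x y) · (∑_y q x y · ‖S x y‖²) for every x, and (iii) ‖S x y‖ ≤ σ for all x, y. Define V x = ∑_y q x y · r x y and g = ∑_{x,y} p x · q x y · r x y • S x y. Let (Ω, F, ℙ) carry ξ : Ω → X, υ : Ω → Y with joint law ℙ(ξ = x, υ = y) = p x · q x y, and for each n a random baseline W_n : Ω → (X → ℝ) independent of (ξ, υ) with 𝔼[(W_n x)²] < ∞ for every x. Then for every n, 0 ≤ 𝔼[‖(r ξ υ − W_n ξ) • S ξ υ − g‖²] − 𝔼[‖(r ξ υ − V ξ) • S ξ υ − g‖²] ≤ σ² · 𝔼[(W_n ξ − V ξ)²]; consequently, if 𝔼[(W_n ξ − V ξ)²] → 0 as n → ∞, then the MSE of the estimator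 with baseline W_n converges to the MSE of the oracle estimator with baseline V. -/
open MeasureTheory ProbabilityTheory Filter

/-- If `Z` takes finitely many values and is independent of `T`, the expectation of `f Z T` is
computed by conditioning on the value of `Z`. -/
theorem integral_eq_sum_measureReal_mul_integral_of_indepFun {Ω α β : Type*} [MeasurableSpace Ω]
    [Fintype α] [MeasurableSpace α] [MeasurableSingletonClass α] [MeasurableSpace β]
    {P : Measure Ω} [IsProbabilityMeasure P] {Z : Ω → α} {T : Ω → β} (hZ : Measurable Z)
    (hT : Measurable T) (hind : IndepFun Z T P) {f : α → β → ℝ} (hf : ∀ a, Measurable (f a))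
    (hint : ∀ a, Integrable (fun ω => f a (T ω)) P) :
    ∫ ω, f (Z ω) (T ω) ∂P = ∑ a, P.real {ω | Z ω = a} * ∫ ω, f a (T ω) ∂P := by
  classical
  have hmeas : ∀ a, MeasurableSet {ω | Z ω = a} := fun a => hZ (measurableSet_singleton a)
  have hsplit : ∀ ω, f (Z ω) (T ω)
      = ∑ a, {ω | Z ω = a}.indicator (fun ω => f a (T ω)) ω := by
    intro ω
    rw [Finset.sum_eq_single (Z ω)]
    · simp
    · intro a _ ha
      simp [Ne.symm ha]
    · simp
  simp_rw [hsplit]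
  rw [integral_finsetSum _ fun a _ => (hint a).indicator (hmeas a)]
  refine Finset.sum_congr rfl fun a _ => ?_
  have hmul : ({ω | Z ω = a}.indicator fun ω => f a (T ω))
      = fun ω => ({a} : Set α).indicator (fun _ => (1 : ℝ)) (Z ω) * f a (T ω) := by
    ext ω
    by_cases h : Z ω = a <;> simp [h]
  have hone : Measurable (({a} : Set α).indicator fun _ => (1 : ℝ)) :=
    measurable_const.indicator (measurableSet_singleton a)
  rw [hmul, hind.integral_fun_comp_mul_comp hZ.aemeasurable hT.aemeasurable
    hone.aestronglyMeasurable (hf a).aestronglyMeasurable]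
  congr 1
  have hindicator : (fun ω => ({a} : Set α).indicator (fun _ => (1 : ℝ)) (Z ω))
      = {ω | Z ω = a}.indicator 1 := by
    ext ω
    by_cases h : Z ω = a <;> simp [h]
  rw [hindicator, integral_indicator_one (hmeas a)]

/-- The weighted mean squared error of a score-based estimator with baseline `w` exceeds the one
with the mean reward `v` as baseline by `(w - v) ^ 2` times the mean squared norm of the score. -/
theorem sum_mul_norm_sub_smul_sub_sq {Y E : Type*} [Fintype Y] [NormedAddCommGroup E]
    [InnerProductSpace ℝ E] {q r : Y → ℝ} {S : Y → E} {v : ℝ} (g : E)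
    (hzero : ∑ y, q y • S y = 0)
    (huncorr : ∑ y, q y * r y * ‖S y‖ ^ 2 = v * ∑ y, q y * ‖S y‖ ^ 2) (w : ℝ) :
    ∑ y, q y * ‖(r y - w) • S y - g‖ ^ 2
      = ∑ y, q y * ‖(r y - v) • S y - g‖ ^ 2 + (∑ y, q y * ‖S y‖ ^ 2) * (w - v) ^ 2 := by
  have hinner : ∑ y, q y * inner ℝ (S y) g = 0 := by
    simpa [sum_inner, real_inner_smul_left] using congrArg (fun z => inner ℝ z g) hzero
  have hexp : ∀ c : ℝ, ∑ y, q y * ‖(r y - c) • S y - g‖ ^ 2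
      = ∑ y, q y * r y ^ 2 * ‖S y‖ ^ 2 - 2 * c * ∑ y, q y * r y * ‖S y‖ ^ 2
        + c ^ 2 * ∑ y, q y * ‖S y‖ ^ 2 - 2 * ∑ y, q y * r y * inner ℝ (S y) g
        + 2 * c * ∑ y, q y * inner ℝ (S y) g + ∑ y, q y * ‖g‖ ^ 2 := by
    intro c
    simp only [Finset.mul_sum, ← Finset.sum_add_distrib, ← Finset.sum_sub_distrib]
    refine Finset.sum_congr rfl fun y _ => ?_
    rw [norm_sub_sq_real, real_inner_smul_left, norm_smul, mul_pow, Real.norm_eq_abs, sq_abs]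
    ring
  rw [hexp, hexp, hinner, huncorr]
  ring

/-- **Oracle property of the gradient estimator (Corollary 2, gradient part).**
With bounded scores `‖S x y‖ ≤ σ`, the excess MSE of the gradient estimator
built from an independent random baseline `W n` over the oracle MSE is
nonnegative and at most `σ² · 𝔼[(W n ξ − V ξ)²]`; consequently, if the
value-estimation MSE vanishes, the MSE of the feasible estimator converges to
the oracle MSE. -/
theorem gradient_estimator_oracle_property {X : Type*} {Y : Type*}
    [Fintype X] [Nonempty X] [Fintype Y] [Nonempty Y]
    [MeasurableSpace X] [MeasurableSingletonClass X]
    [MeasurableSpace Y] [MeasurableSingletonClass Y] (d : ℕ)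
    (p : X → ℝ) (hp : ∀ x, 0 ≤ p x) (hpsum : ∑ x, p x = 1)
    (q : X → Y → ℝ) (hq : ∀ x y, 0 ≤ q x y) (hqsum : ∀ x, ∑ y, q x y = 1)
    (r : X → Y → ℝ) (S : X → Y → EuclideanSpace ℝ (Fin d)) (σ : ℝ)
    (hzero : ∀ x, ∑ y, q x y • S x y = 0)
    (huncorr : ∀ x, ∑ y, q x y * r x y * ‖S x y‖ ^ 2 =
      (∑ y, q x y * r x y) * (∑ y, q x y * ‖S x y‖ ^ 2))
    (hSbdd : ∀ x y, ‖S x y‖ ≤ σ)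
    (V : X → ℝ) (hV : ∀ x, V x = ∑ y, q x y * r x y)
    (g : EuclideanSpace ℝ (Fin d))
    (hg : g = ∑ x, ∑ y, (p x * q x y * r x y) • S x y)
    {Ω : Type*} [MeasurableSpace Ω] (P : Measure Ω) [IsProbabilityMeasure P]
    (ξ : Ω → X) (υ : Ω → Y) (W : ℕ → Ω → X → ℝ)
    (hξ : Measurable ξ) (hυ : Measurable υ) (hW : ∀ n, Measurable (W n))
    (hlaw : ∀ x y, P {ω | ξ ω = x ∧ υ ω = y} = ENNReal.ofReal (p x * q x y))
    (hindep : ∀ n, IndepFun (fun ω => (ξ ω, υ ω)) (W n) P)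
    (hWL2 : ∀ n x, Integrable (fun ω => (W n ω x) ^ 2) P) :
    (∀ n : ℕ,
      0 ≤ (∫ ω, ‖(r (ξ ω) (υ ω) - W n ω (ξ ω)) • S (ξ ω) (υ ω) - g‖ ^ 2 ∂P) -
          (∫ ω, ‖(r (ξ ω) (υ ω) - V (ξ ω)) • S (ξ ω) (υ ω) - g‖ ^ 2 ∂P) ∧
      (∫ ω, ‖(r (ξ ω) (υ ω) - W n ω (ξ ω)) • S (ξ ω) (υ ω) - g‖ ^ 2 ∂P) -
          (∫ ω, ‖(r (ξ ω) (υ ω) - V (ξ ω)) • S (ξ ω) (υ ω) - g‖ ^ 2 ∂P) ≤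
        σ ^ 2 * ∫ ω, (W n ω (ξ ω) - V (ξ ω)) ^ 2 ∂P) ∧
    (Tendsto (fun n => ∫ ω, (W n ω (ξ ω) - V (ξ ω)) ^ 2 ∂P) atTop (nhds 0) →
      Tendsto
        (fun n => ∫ ω, ‖(r (ξ ω) (υ ω) - W n ω (ξ ω)) • S (ξ ω) (υ ω) - g‖ ^ 2 ∂P)
        atTop
        (nhds (∫ ω, ‖(r (ξ ω) (υ ω) - V (ξ ω)) • S (ξ ω) (υ ω) - g‖ ^ 2 ∂P))) := by
  have hreal : ∀ a : X × Y, P.real {ω | (ξ ω, υ ω) = a} = p a.1 * q a.1 a.2 := by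
    rintro ⟨x, y⟩
    simp only [Prod.mk.injEq, measureReal_def, hlaw]
    exact ENNReal.toReal_ofReal (mul_nonneg (hp x) (hq x y))
  have hsq : ∀ U : Ω → X → ℝ, Measurable U → (∀ x, Integrable (fun ω => U ω x ^ 2) P) →
      ∀ (x : X) (c : ℝ), Integrable (fun ω => (U ω x - c) ^ 2) P := by
    intro U hU hU2 x c
    have hL2 : MemLp (fun ω => U ω x) 2 P :=
      (memLp_two_iff_integrable_sq ((measurable_pi_apply x).comp hU).aestronglyMeasurable).2
        (hU2 x)
    exact (hL2.sub (memLp_const c)).integrable_sq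
  have hmse : ∀ U : Ω → X → ℝ, Measurable U → (∀ x, Integrable (fun ω => U ω x ^ 2) P) →
      IndepFun (fun ω => (ξ ω, υ ω)) U P →
      ∫ ω, ‖(r (ξ ω) (υ ω) - U ω (ξ ω)) • S (ξ ω) (υ ω) - g‖ ^ 2 ∂P
        = ∑ x, p x * ∑ y, q x y * ‖(r x y - V x) • S x y - g‖ ^ 2
          + ∑ x, p x * ((∑ y, q x y * ‖S x y‖ ^ 2) * ∫ ω, (U ω x - V x) ^ 2 ∂P) := by
    intro U hU hU2 hUind
    have hint : ∀ x y, Integrable (fun ω => ‖(r x y - U ω x) • S x y - g‖ ^ 2) P := by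
      intro x y
      have hL2 : MemLp (fun ω => U ω x) 2 P :=
        (memLp_two_iff_integrable_sq ((measurable_pi_apply x).comp hU).aestronglyMeasurable).2
          (hU2 x)
      have hL2' : MemLp (fun ω => (r x y - U ω x) • S x y - g) 2 P := by
        refine MemLp.sub ?_ (memLp_const g)
        exact ((ContinuousLinearMap.toSpanSingleton ℝ (S x y)).comp_memLp'
          ((memLp_const (r x y)).sub hL2))
      exact hL2'.integrable_norm_pow two_ne_zero
    rw [integral_eq_sum_measureReal_mul_integral_of_indepFun (hξ.prodMk hυ) hU hUind
      (f := fun a u => ‖(r a.1 a.2 - u a.1) • S a.1 a.2 - g‖ ^ 2)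
      (fun a => by fun_prop) (fun a => hint a.1 a.2)]
    simp_rw [hreal]
    rw [Fintype.sum_prod_type, ← Finset.sum_add_distrib]
    refine Finset.sum_congr rfl fun x _ => ?_
    simp_rw [mul_assoc]
    rw [← Finset.mul_sum, ← mul_add]
    congr 1
    simp_rw [← integral_const_mul]
    rw [← integral_finsetSum _ fun y _ => (hint x y).const_mul _]
    have huncorr' := huncorr x
    rw [← hV] at huncorr'
    rw [integral_congr_ae (ae_of_all P fun ω =>
      sum_mul_norm_sub_smul_sub_sq g (hzero x) huncorr' (U ω x))]
    rw [integral_add (integrable_const _) ((hsq U hU hU2 x _).const_mul _), integral_const_mul]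
    simp
  have hvalue : ∀ n, ∫ ω, (W n ω (ξ ω) - V (ξ ω)) ^ 2 ∂P
      = ∑ x, p x * ∫ ω, (W n ω x - V x) ^ 2 ∂P := by
    intro n
    rw [integral_eq_sum_measureReal_mul_integral_of_indepFun (hξ.prodMk hυ) (hW n) (hindep n)
      (f := fun a u => (u a.1 - V a.1) ^ 2)
      (fun a => by fun_prop) (fun a => hsq _ (hW n) (hWL2 n) a.1 _)]
    simp_rw [hreal]
    rw [Fintype.sum_prod_type]
    refine Finset.sum_congr rfl fun x _ => ?_
    dsimp only
    rw [← Finset.sum_mul, ← Finset.mul_sum, hqsum, mul_one]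
  have horacle := hmse (fun _ => V) measurable_const (fun x => integrable_const _)
    (indepFun_const_right _ V)
  simp only [sub_self, ne_eq, OfNat.ofNat_ne_zero, not_false_eq_true, zero_pow, integral_zero,
    mul_zero, Finset.sum_const_zero, add_zero] at horacle
  have hscore_nonneg : ∀ x, 0 ≤ ∑ y, q x y * ‖S x y‖ ^ 2 := fun x =>
    Finset.sum_nonneg fun y _ => mul_nonneg (hq x y) (sq_nonneg _)
  have hscore_le : ∀ x, ∑ y, q x y * ‖S x y‖ ^ 2 ≤ σ ^ 2 := fun x => calc
    ∑ y, q x y * ‖S x y‖ ^ 2 ≤ ∑ y, q x y * σ ^ 2 := by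
      gcongr with y
      · exact hq x y
      · exact hSbdd x y
    _ = σ ^ 2 := by rw [← Finset.sum_mul, hqsum, one_mul]
  have hbounds : ∀ n : ℕ,
      0 ≤ (∫ ω, ‖(r (ξ ω) (υ ω) - W n ω (ξ ω)) • S (ξ ω) (υ ω) - g‖ ^ 2 ∂P) -
          (∫ ω, ‖(r (ξ ω) (υ ω) - V (ξ ω)) • S (ξ ω) (υ ω) - g‖ ^ 2 ∂P) ∧
      (∫ ω, ‖(r (ξ ω) (υ ω) - W n ω (ξ ω)) • S (ξ ω) (υ ω) - g‖ ^ 2 ∂P) -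
          (∫ ω, ‖(r (ξ ω) (υ ω) - V (ξ ω)) • S (ξ ω) (υ ω) - g‖ ^ 2 ∂P) ≤
        σ ^ 2 * ∫ ω, (W n ω (ξ ω) - V (ξ ω)) ^ 2 ∂P := by
    intro n
    have hnonneg : ∀ x, 0 ≤ ∫ ω, (W n ω x - V x) ^ 2 ∂P := fun x =>
      integral_nonneg fun ω => sq_nonneg _
    rw [hmse _ (hW n) (hWL2 n) (hindep n), horacle, hvalue, add_sub_cancel_left]
    refine ⟨Finset.sum_nonneg fun x _ =>
      mul_nonneg (hp x) (mul_nonneg (hscore_nonneg x) (hnonneg x)), ?_⟩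
    rw [Finset.mul_sum]
    refine Finset.sum_le_sum fun x _ => ?_
    rw [mul_left_comm (σ ^ 2)]
    exact mul_le_mul_of_nonneg_left
      (mul_le_mul_of_nonneg_right (hscore_le x) (hnonneg x)) (hp x)
  refine ⟨hbounds, fun hlim => ?_⟩
  rw [← tendsto_sub_nhds_zero_iff]
  exact squeeze_zero (fun n => (hbounds n).1) (fun n => (hbounds n).2)
    (by simpa using hlim.const_mul (σ ^ 2))
end
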